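/- Let (Ā,τ̄) be a solution of system (1.1) on [0,t*] (t* > 0) with initial distribution (φ̄,τ̄₀) ∈ Lip_α × C_+(Ω). Then for every ε > 0 there exists δ > 0 such that: for every (φ,τ₀) ∈ Lip_α × C_+(Ω) with ‖φ − φ̄‖_{Lip_α} + ‖τ₀ − τ̄₀‖_∞ ≤ δ and every solution (A,τ) of system (1.1) on [0,t*] with initial distribution (φ,τ₀), one has sup_{t∈[0,t*]} ‖A(t,·) − Ā(t,·)‖_∞ ≤ ε. -/

import Mathlib

open scoped NNReal
open MeasureTheory intervalIntegral Set

/-- The weighted history `φ_α(t) = e^{−α|t|} φ(t)`. -/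
noncomputable def weightedHist {Ω : Type*} [TopologicalSpace Ω]
    (α : ℝ) (φ : ℝ → C(Ω, ℝ)) : ℝ → C(Ω, ℝ) :=
  fun t => Real.exp (-(α * |t|)) • φ t

/-- Membership in `Lip_α`: `φ_α` is bounded and Lipschitz from `(−∞,0]` to `C(Ω)`. -/
def MemLipAlpha {Ω : Type*} [TopologicalSpace Ω] [CompactSpace Ω]
    (α : ℝ) (φ : ℝ → C(Ω, ℝ)) : Prop :=
  ContinuousOn φ (Set.Iic 0) ∧
  (∃ C : ℝ, ∀ t ≤ (0 : ℝ), ‖weightedHist α φ t‖ ≤ C) ∧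
  (∃ L : ℝ≥0, LipschitzOnWith L (weightedHist α φ) (Set.Iic 0))

/-- The norm of `Lip_α`: `‖φ_α‖_∞ + ‖φ_α‖_{Lip}`. -/
noncomputable def lipAlphaNorm {Ω : Type*} [TopologicalSpace Ω] [CompactSpace Ω]
    (α : ℝ) (φ : ℝ → C(Ω, ℝ)) : ℝ :=
  sSup {c : ℝ | ∃ t ≤ (0 : ℝ), c = ‖weightedHist α φ t‖} +
  sSup {c : ℝ | ∃ t ≤ (0 : ℝ), ∃ s ≤ (0 : ℝ), t ≠ s ∧
    c = ‖weightedHist α φ t - weightedHist α φ s‖ / |t - s|}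

/-- `F : C(Ω)² × C(Ω×Ω) → C(Ω)` is Lipschitz continuous on bounded sets. -/
def LipschitzOnBoundedSets {Ω : Type*} [TopologicalSpace Ω] [CompactSpace Ω]
    (F : C(Ω, ℝ) → C(Ω, ℝ) → C(Ω × Ω, ℝ) → C(Ω, ℝ)) : Prop :=
  ∀ M : ℝ, 0 < M → ∃ L : ℝ, 0 < L ∧
    ∀ u v : C(Ω, ℝ), ∀ w : C(Ω × Ω, ℝ), ∀ u' v' : C(Ω, ℝ), ∀ w' : C(Ω × Ω, ℝ),
      ‖u‖ ≤ M → ‖v‖ ≤ M → ‖w‖ ≤ M → ‖u'‖ ≤ M → ‖v'‖ ≤ M → ‖w'‖ ≤ M →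
      ‖F u v w - F u' v' w'‖ ≤ L * (‖u - u'‖ + ‖v - v'‖ + ‖w - w'‖)

/-- A solution of system (1.1) on [0,r] with initial distribution (φ,τ₀):
a pair of continuous maps `A : (−∞,r] → C(Ω)` and `τ : [0,r] → C₊(Ω)` such that
`A = φ` on `(−∞,0]`, `A(t,x) = φ(0,x) + ∫₀ᵗ F(A(l,·), τ(l,·), A(l−τ(l))(·,·))(x) dl`
for `t ∈ [0,r]` (where `A(l−τ(l))(x,y) = A(l−τ(l,x),y)`), and
`∫_{t−τ(t,x)}^{t} f(A(s,·))(x) ds = ∫_{−τ₀(x)}^{0} f(φ(s,·))(x) ds` on `[0,r]`. -/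
def IsSolutionOn {Ω : Type*} [TopologicalSpace Ω] [CompactSpace Ω]
    (F : C(Ω, ℝ) → C(Ω, ℝ) → C(Ω × Ω, ℝ) → C(Ω, ℝ))
    (f : C(Ω, ℝ) → C(Ω, ℝ))
    (φ : ℝ → C(Ω, ℝ)) (τ₀ : C(Ω, ℝ)) (r : ℝ)
    (A : ℝ → C(Ω, ℝ)) (τ : ℝ → C(Ω, ℝ)) : Prop :=
  ContinuousOn A (Set.Iic r) ∧
  ContinuousOn τ (Set.Icc 0 r) ∧
  (∀ t ∈ Set.Icc (0 : ℝ) r, ∀ x : Ω, 0 ≤ τ t x) ∧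
  (∀ t ≤ (0 : ℝ), A t = φ t) ∧
  (∃ w : ℝ → C(Ω × Ω, ℝ),
    (∀ l ∈ Set.Icc (0 : ℝ) r, ∀ x y : Ω, w l (x, y) = A (l - τ l x) y) ∧
    (∀ t ∈ Set.Icc (0 : ℝ) r, ∀ x : Ω,
      A t x = φ 0 x + ∫ l in (0 : ℝ)..t, F (A l) (τ l) (w l) x)) ∧
  (∀ t ∈ Set.Icc (0 : ℝ) r, ∀ x : Ω,
    (∫ s in (t - τ t x)..t, f (A s) x) = ∫ s in (-(τ₀ x))..(0 : ℝ), f (φ s) x)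

/-- Continuous induction: a function that is negative at `0`, and negative wherever it has been
nonpositive so far, stays negative. -/
lemma neg_of_forall_nonpos_imp_neg {h : ℝ → ℝ} {r : ℝ} (hc : ContinuousOn h (Icc 0 r))
    (h0 : h 0 < 0)
    (hstep : ∀ t ∈ Icc (0 : ℝ) r, (∀ s ∈ Icc (0 : ℝ) t, h s ≤ 0) → h t < 0) :
    ∀ t ∈ Icc (0 : ℝ) r, h t < 0 := by
  by_contra! hcon
  obtain ⟨t₁, ht₁, ht₁'⟩ := hcon
  have hcl : IsClosed (Icc 0 r ∩ h ⁻¹' Ici 0) :=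
    hc.preimage_isClosed_of_isClosed isClosed_Icc isClosed_Ici
  have hcpt : IsCompact (Icc 0 r ∩ h ⁻¹' Ici 0) :=
    isCompact_Icc.of_isClosed_subset hcl inter_subset_left
  obtain ⟨t₀, ⟨ht₀, hht₀⟩, hleast⟩ := hcpt.exists_isLeast ⟨t₁, ht₁, ht₁'⟩
  have hneg : ∀ s ∈ Ico (0 : ℝ) t₀, h s < 0 := by
    intro s hs
    by_contra! hcon
    exact absurd (hleast ⟨⟨hs.1, hs.2.le.trans ht₀.2⟩, hcon⟩) (not_le.2 hs.2)
  have hpos : 0 < t₀ := by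
    rcases ht₀.1.eq_or_lt with h' | h'
    · rw [← h'] at hht₀
      exact absurd hht₀ (not_le.2 h0)
    · exact h'
  have hle : ∀ s ∈ Icc (0 : ℝ) t₀, h s ≤ 0 := by
    rw [← closure_Ico hpos.ne]
    refine fun s hs => le_on_closure (f := h) (g := fun _ => 0) (fun s hs => (hneg s hs).le) ?_
      continuousOn_const hs
    rw [closure_Ico hpos.ne]
    exact hc.mono (Icc_subset_Icc_right ht₀.2)
  exact absurd (hstep t₀ ht₀ hle) (not_lt.2 hht₀)

lemma abs_exp_sub_exp_le {a b c : ℝ} (ha : a ≤ c) (hb : b ≤ c) :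
    |Real.exp a - Real.exp b| ≤ Real.exp c * |a - b| := by
  have key : ∀ {a b : ℝ}, b ≤ a → a ≤ c →
      |Real.exp a - Real.exp b| ≤ Real.exp c * |a - b| := by
    intro a b hba hac
    rw [abs_of_nonneg (sub_nonneg.2 (Real.exp_le_exp.2 hba)), abs_of_nonneg (sub_nonneg.2 hba)]
    have h1 : Real.exp b = Real.exp a * Real.exp (b - a) := by
      rw [← Real.exp_add]; ring_nf
    have h2 := Real.add_one_le_exp (b - a)
    have h3 := Real.exp_le_exp.2 hac
    have h4 := Real.exp_pos a
    nlinarith [mul_le_mul_of_nonneg_left h2 h4.le,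
      mul_le_mul_of_nonneg_right h3 (sub_nonneg.2 hba)]
  rcases le_total b a with h | h
  · exact key h ha
  · rw [abs_sub_comm, abs_sub_comm a]
    exact key h hb

lemma mul_abs_sub_le_abs_integral {g : ℝ → ℝ} {p q m a b : ℝ} (hg : ContinuousOn g (Icc p q))
    (hm : ∀ s ∈ Icc p q, m ≤ g s) (ha : a ∈ Icc p q) (hb : b ∈ Icc p q) :
    m * |b - a| ≤ |∫ s in a..b, g s| := by
  have key : ∀ {a b : ℝ}, a ∈ Icc p q → b ∈ Icc p q → a ≤ b →
      m * |b - a| ≤ |∫ s in a..b, g s| := by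
    intro a b ha hb hab
    have hsub : Icc a b ⊆ Icc p q := Icc_subset_Icc ha.1 hb.2
    have hmono := intervalIntegral.integral_mono_on (f := fun _ => m) (μ := volume) hab
      intervalIntegrable_const ((hg.mono hsub).intervalIntegrable_of_Icc hab)
      (fun s hs => hm s (hsub hs))
    rw [abs_of_nonneg (sub_nonneg.2 hab)]
    refine le_trans ?_ (le_abs_self _)
    simpa [mul_comm] using hmono
  rcases le_total a b with h | h
  · exact key ha hb h
  · rw [abs_sub_comm, intervalIntegral.integral_symm, abs_neg]
    exact key hb ha h

/-- Stability of the threshold `a` defined implicitly by `∫_a^t g = ∫_{a₀}^0 g`. -/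
lemma threshold_stability {g k : ℝ → ℝ} {R r t m N η a b a₀ b₀ : ℝ}
    (hg : ContinuousOn g (Icc (-R) r)) (hk : ContinuousOn k (Icc (-R) r))
    (hm : ∀ s ∈ Icc (-R) r, m ≤ k s) (hN : ∀ s ∈ Icc (-R) r, |k s| ≤ N)
    (ht : t ∈ Icc 0 r) (ha₀ : a₀ ∈ Icc (-R) 0) (hb₀ : b₀ ∈ Icc (-R) 0)
    (ha : a ∈ Icc (-R) t) (hb : b ∈ Icc (-R) t)
    (hga : ∫ s in a..t, g s = ∫ s in a₀..0, g s) (hkb : ∫ s in b..t, k s = ∫ s in b₀..0, k s)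
    (hη0 : 0 ≤ η) (hη : ∀ s ∈ Icc (-R) t, |g s - k s| ≤ η) :
    m * |a - b| ≤ N * |a₀ - b₀| + 2 * η * (R + r) := by
  obtain ⟨ht0, htr⟩ := ht
  have hi : ∀ {h : ℝ → ℝ}, ContinuousOn h (Icc (-R) r) → ∀ {u v : ℝ}, u ∈ Icc (-R) r →
      v ∈ Icc (-R) r → IntervalIntegrable h volume u v := fun hh _ _ hu hv =>
    (hh.mono (uIcc_subset_Icc hu hv)).intervalIntegrable
  have hRa : -R ≤ 0 := ha₀.1.trans ha₀.2
  have m0 : (0 : ℝ) ∈ Icc (-R) r := ⟨hRa, ht0.trans htr⟩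
  have mt : t ∈ Icc (-R) r := ⟨hRa.trans ht0, htr⟩
  have ma : a ∈ Icc (-R) r := ⟨ha.1, ha.2.trans htr⟩
  have mb : b ∈ Icc (-R) r := ⟨hb.1, hb.2.trans htr⟩
  have ma₀ : a₀ ∈ Icc (-R) r := ⟨ha₀.1, ha₀.2.trans m0.2⟩
  have mb₀ : b₀ ∈ Icc (-R) r := ⟨hb₀.1, hb₀.2.trans m0.2⟩
  have e1 := intervalIntegral.integral_sub (hi hg ma mt) (hi hk ma mt)
  have e2 := intervalIntegral.integral_sub (hi hg ma₀ m0) (hi hk ma₀ m0)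
  have e3 := intervalIntegral.integral_add_adjacent_intervals (hi hk ma mb) (hi hk mb mt)
  have e4 := intervalIntegral.integral_add_adjacent_intervals (hi hk ma₀ mb₀) (hi hk mb₀ m0)
  have b1 : |∫ s in a..t, (g s - k s)| ≤ η * |t - a| :=
    intervalIntegral.norm_integral_le_of_norm_le_const (f := fun s => g s - k s) fun s hs =>
      hη s (uIcc_subset_Icc ha ⟨mt.1, le_rfl⟩ (uIoc_subset_uIcc hs))
  have b2 : |∫ s in a₀..0, (g s - k s)| ≤ η * |0 - a₀| :=
    intervalIntegral.norm_integral_le_of_norm_le_const (f := fun s => g s - k s) fun s hs =>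
      hη s (uIcc_subset_Icc ⟨ha₀.1, ha₀.2.trans ht0⟩ ⟨hRa, ht0⟩ (uIoc_subset_uIcc hs))
  have b3 : |∫ s in a₀..b₀, k s| ≤ N * |b₀ - a₀| :=
    intervalIntegral.norm_integral_le_of_norm_le_const (f := k) fun s hs =>
      hN s (uIcc_subset_Icc ma₀ mb₀ (uIoc_subset_uIcc hs))
  have hlow := mul_abs_sub_le_abs_integral hk hm ma mb
  have heq : ∫ s in a..b, k s = -(∫ s in a..t, (g s - k s)) + (∫ s in a₀..0, (g s - k s))
      + ∫ s in a₀..b₀, k s := by linarith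
  rw [heq] at hlow
  have htri := abs_add_three (-(∫ s in a..t, (g s - k s))) (∫ s in a₀..0, (g s - k s))
    (∫ s in a₀..b₀, k s)
  rw [abs_neg] at htri
  rw [abs_sub_comm a b, abs_sub_comm a₀ b₀]
  have c1 : η * |t - a| ≤ η * (R + r) :=
    mul_le_mul_of_nonneg_left (abs_le.2 ⟨by linarith [ha.2], by linarith [ha.1]⟩) hη0
  have c2 : η * |0 - a₀| ≤ η * (R + r) :=
    mul_le_mul_of_nonneg_left (abs_le.2 ⟨by linarith [ha₀.2], by linarith [ha₀.1]⟩) hη0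
  linarith

lemma ContinuousOn.continuousMap_eval {X : Type*} [TopologicalSpace X] {h : ℝ → C(X, ℝ)}
    {S : Set ℝ} (hh : ContinuousOn h S) (x : X) : ContinuousOn (fun s => h s x) S :=
  (ContinuousEvalConst.continuous_eval_const x).comp_continuousOn hh

section

variable {X : Type*} [TopologicalSpace X] [CompactSpace X]

lemma abs_apply_sub_apply_le (u v : C(X, ℝ)) (x : X) : |u x - v x| ≤ ‖u - v‖ :=
  (u - v).norm_coe_le_norm x

/-- The norm of `Lip_α` and the sup norm together control the histories pointwise in time. -/
lemma norm_sub_le_of_lipAlphaNorm_add_le {α : ℝ} {φ ψ : ℝ → C(X, ℝ)} {c δ : ℝ}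
    (hφ : MemLipAlpha α φ) (hψ : MemLipAlpha α ψ) (hc : 0 ≤ c)
    (h : lipAlphaNorm α (fun t : ℝ => φ t - ψ t) + c ≤ δ) :
    c ≤ δ ∧ ∀ t ≤ (0 : ℝ), ‖φ t - ψ t‖ ≤ Real.exp (α * |t|) * δ := by
  obtain ⟨-, ⟨C₁, hC₁⟩, -⟩ := hφ
  obtain ⟨-, ⟨C₂, hC₂⟩, -⟩ := hψ
  have hbdd : BddAbove {c : ℝ | ∃ t ≤ (0 : ℝ), c = ‖weightedHist α (fun t => φ t - ψ t) t‖} := by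
    refine ⟨C₁ + C₂, ?_⟩
    rintro _ ⟨t, ht, rfl⟩
    have : weightedHist α (fun t => φ t - ψ t) t = weightedHist α φ t - weightedHist α ψ t := by
      simp [weightedHist, smul_sub]
    rw [this]
    exact (norm_sub_le _ _).trans (add_le_add (hC₁ t ht) (hC₂ t ht))
  have h1 : 0 ≤ sSup {c : ℝ | ∃ t ≤ (0 : ℝ), c = ‖weightedHist α (fun t => φ t - ψ t) t‖} := by
    refine Real.sSup_nonneg ?_
    rintro _ ⟨t, _, rfl⟩
    exact norm_nonneg _
  have h2 : 0 ≤ sSup {c : ℝ | ∃ t ≤ (0 : ℝ), ∃ s ≤ (0 : ℝ), t ≠ s ∧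
      c = ‖weightedHist α (fun t => φ t - ψ t) t - weightedHist α (fun t => φ t - ψ t) s‖
        / |t - s|} := by
    refine Real.sSup_nonneg ?_
    rintro _ ⟨t, _, s, _, _, rfl⟩
    positivity
  unfold lipAlphaNorm at h
  refine ⟨by linarith, fun t ht => ?_⟩
  have h3 := le_csSup hbdd ⟨t, ht, rfl⟩
  have h4 : ‖weightedHist α (fun t => φ t - ψ t) t‖ ≤ δ := by linarith
  have h5 : φ t - ψ t = Real.exp (α * |t|) • weightedHist α (fun t => φ t - ψ t) t := by
    simp only [weightedHist]
    rw [smul_smul, ← Real.exp_add]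
    simp
  rw [h5, norm_smul, Real.norm_of_nonneg (Real.exp_pos _).le]
  exact mul_le_mul_of_nonneg_left h4 (Real.exp_pos _).le

/-- A history in `Lip_α` is Lipschitz on compact time intervals. -/
lemma MemLipAlpha.exists_lipschitz {α R : ℝ} {φ : ℝ → C(X, ℝ)} (hα : 0 ≤ α)
    (hφ : MemLipAlpha α φ) :
    ∃ L : ℝ, 0 ≤ L ∧ ∀ s ∈ Icc (-R) 0, ∀ t ∈ Icc (-R) 0, ‖φ s - φ t‖ ≤ L * |s - t| := by
  obtain ⟨-, ⟨C, hC⟩, ⟨K, hK⟩⟩ := hφ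
  have hC0 : 0 ≤ C := (norm_nonneg _).trans (hC 0 le_rfl)
  refine ⟨Real.exp (α * R) * K + Real.exp (α * R) * α * C, by positivity, fun s hs t ht => ?_⟩
  have hrep : ∀ u ≤ (0 : ℝ), φ u = Real.exp (-(α * u)) • weightedHist α φ u := by
    intro u hu
    simp only [weightedHist]
    rw [smul_smul, ← Real.exp_add, abs_of_nonpos hu]
    simp
  have hsplit : φ s - φ t = Real.exp (-(α * s)) • (weightedHist α φ s - weightedHist α φ t)
      + (Real.exp (-(α * s)) - Real.exp (-(α * t))) • weightedHist α φ t := by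
    rw [hrep s hs.2, hrep t ht.2, smul_sub, sub_smul]
    abel_nf
  have hs' : -(α * s) ≤ α * R := by nlinarith [hs.1]
  have ht' : -(α * t) ≤ α * R := by nlinarith [ht.1]
  have e1 : ‖weightedHist α φ s - weightedHist α φ t‖ ≤ K * |s - t| := by
    simpa [dist_eq_norm] using hK.dist_le_mul s hs.2 t ht.2
  have e2 : |Real.exp (-(α * s)) - Real.exp (-(α * t))| ≤ Real.exp (α * R) * (α * |s - t|) := by
    refine (abs_exp_sub_exp_le hs' ht').trans_eq ?_
    rw [show -(α * s) - -(α * t) = α * (t - s) by ring, abs_mul, abs_of_nonneg hα, abs_sub_comm]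
  rw [hsplit]
  refine (norm_add_le _ _).trans ?_
  rw [norm_smul, norm_smul, Real.norm_of_nonneg (Real.exp_pos _).le, Real.norm_eq_abs]
  calc _ ≤ Real.exp (α * R) * (K * |s - t|) + Real.exp (α * R) * (α * |s - t|) * C := by
        gcongr
        exact hC t ht.2
    _ = _ := by ring

lemma LipschitzOnBoundedSets.continuous {F : C(X, ℝ) → C(X, ℝ) → C(X × X, ℝ) → C(X, ℝ)}
    (hF : LipschitzOnBoundedSets F) :
    Continuous fun p : C(X, ℝ) × C(X, ℝ) × C(X × X, ℝ) => F p.1 p.2.1 p.2.2 := by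
  refine continuous_iff_continuousAt.2 fun p => ?_
  obtain ⟨L, -, hL⟩ := hF (‖p‖ + 1) (by positivity)
  have hb : ∀ q : C(X, ℝ) × C(X, ℝ) × C(X × X, ℝ), ‖q‖ ≤ ‖p‖ + 1 →
      ‖q.1‖ ≤ ‖p‖ + 1 ∧ ‖q.2.1‖ ≤ ‖p‖ + 1 ∧ ‖q.2.2‖ ≤ ‖p‖ + 1 := fun q hq =>
    ⟨(norm_fst_le q).trans hq, (norm_fst_le q.2).trans ((norm_snd_le q).trans hq),
      (norm_snd_le q.2).trans ((norm_snd_le q).trans hq)⟩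
  rw [ContinuousAt, tendsto_iff_norm_sub_tendsto_zero]
  have hlim : Filter.Tendsto (fun q : C(X, ℝ) × C(X, ℝ) × C(X × X, ℝ) =>
      L * (‖q.1 - p.1‖ + ‖q.2.1 - p.2.1‖ + ‖q.2.2 - p.2.2‖)) (nhds p) (nhds 0) := by
    have : Continuous (fun q : C(X, ℝ) × C(X, ℝ) × C(X × X, ℝ) =>
      L * (‖q.1 - p.1‖ + ‖q.2.1 - p.2.1‖ + ‖q.2.2 - p.2.2‖)) := by fun_prop
    simpa using this.tendsto p
  refine squeeze_zero' (Filter.Eventually.of_forall fun _ => norm_nonneg _) ?_ hlim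
  have hnear : ∀ᶠ q in nhds p, ‖q‖ < ‖p‖ + 1 :=
    continuous_norm.continuousAt.eventually_lt_const (lt_add_one _)
  filter_upwards [hnear] with q hq
  obtain ⟨h1, h2, h3⟩ := hb q hq.le
  obtain ⟨h4, h5, h6⟩ := hb p (lt_add_one _).le
  exact hL _ _ _ _ _ _ h1 h2 h3 h4 h5 h6

lemma continuousOn_delayed [T2Space X] {A τ : ℝ → C(X, ℝ)} {w : ℝ → C(X × X, ℝ)} {R r : ℝ}
    (hRr : -R ≤ r) (hA : ContinuousOn A (Icc (-R) r)) (hτ : ContinuousOn τ (Icc 0 r))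
    (hmem : ∀ l ∈ Icc (0 : ℝ) r, ∀ x, l - τ l x ∈ Icc (-R) r)
    (hw : ∀ l ∈ Icc (0 : ℝ) r, ∀ x y : X, w l (x, y) = A (l - τ l x) y) :
    ContinuousOn w (Icc 0 r) := by
  rw [continuousOn_iff_continuous_domRestrict] at hA hτ ⊢
  refine ContinuousMap.continuous_of_continuous_uncurry _ ?_
  have heq : (Function.uncurry fun (l : Icc (0 : ℝ) r) (p : X × X) =>
      (Icc 0 r).domRestrict w l p) = fun q : Icc (0 : ℝ) r × X × X =>
        ((Icc (-R) r).domRestrict A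
          (projIcc (-R) r hRr (q.1 - (Icc 0 r).domRestrict τ q.1 q.2.1))) q.2.2 := by
    funext ⟨l, x, y⟩
    simp only [Function.uncurry, domRestrict_apply]
    rw [projIcc_of_mem hRr (hmem l l.2 x), hw l l.2]
  rw [heq]
  have hproj := continuous_projIcc (h := hRr)
  fun_prop

section Solution

variable {F : C(X, ℝ) → C(X, ℝ) → C(X × X, ℝ) → C(X, ℝ)} {f : C(X, ℝ) → C(X, ℝ)}
  {φ : ℝ → C(X, ℝ)} {τ₀ : C(X, ℝ)} {r : ℝ} {A τ : ℝ → C(X, ℝ)}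

/-- The delayed time never precedes the initial delayed time. -/
lemma IsSolutionOn.neg_le_sub_delay (h : IsSolutionOn F f φ τ₀ r A τ) (hf : Continuous f)
    (hpos : ∀ ψ x, 0 < f ψ x) (hτ₀ : ∀ x, 0 ≤ τ₀ x) {t : ℝ} (ht : t ∈ Icc (0 : ℝ) r) (x : X) :
    -τ₀ x ≤ t - τ t x := by
  obtain ⟨hA, -, -, hφ, -, hthr⟩ := h
  by_contra! hlt
  have hfA : ContinuousOn (fun s => f (A s) x) (Iic r) :=
    (hf.comp_continuousOn hA).continuousMap_eval x
  have hi : ∀ {u v : ℝ}, u ≤ r → v ≤ r → IntervalIntegrable (fun s => f (A s) x) volume u v :=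
    fun hu hv => (hfA.mono fun s hs => hs.2.trans (max_le hu hv)).intervalIntegrable
  have m0 : (0 : ℝ) ≤ r := ht.1.trans ht.2
  have m1 : -τ₀ x ≤ 0 := neg_nonpos.2 (hτ₀ x)
  have e1 := intervalIntegral.integral_add_adjacent_intervals
    (hi (hlt.le.trans (m1.trans m0)) (m1.trans m0)) (hi (m1.trans m0) m0)
  have e2 := intervalIntegral.integral_add_adjacent_intervals
    (hi (hlt.le.trans (m1.trans m0)) m0) (hi m0 ht.2)
  have e3 : ∫ s in (-(τ₀ x))..(0 : ℝ), f (φ s) x = ∫ s in (-(τ₀ x))..(0 : ℝ), f (A s) x := by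
    refine intervalIntegral.integral_congr fun s hs => ?_
    rw [uIcc_of_le m1] at hs
    simp only [hφ s hs.2]
  have e4 := hthr t ht x
  have p1 : 0 < ∫ s in (t - τ t x)..(-(τ₀ x)), f (A s) x :=
    intervalIntegral.intervalIntegral_pos_of_pos_on
      (hi (hlt.le.trans (m1.trans m0)) (m1.trans m0)) (fun s _ => hpos _ x) hlt
  have p2 : 0 ≤ ∫ s in (0 : ℝ)..t, f (A s) x :=
    intervalIntegral.integral_nonneg ht.1 fun s _ => (hpos _ x).le
  linarith

lemma IsSolutionOn.sub_delay_mem (h : IsSolutionOn F f φ τ₀ r A τ) (hf : Continuous f)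
    (hpos : ∀ ψ x, 0 < f ψ x) (hτ₀ : ∀ x, 0 ≤ τ₀ x) {R : ℝ} (hR : ‖τ₀‖ ≤ R) {t : ℝ}
    (ht : t ∈ Icc (0 : ℝ) r) (x : X) : t - τ t x ∈ Icc (-R) t := by
  have h1 := h.neg_le_sub_delay hf hpos hτ₀ ht x
  have h2 := (le_abs_self _).trans (τ₀.norm_coe_le_norm x)
  exact ⟨by linarith, by linarith [h.2.2.1 t ht x]⟩

lemma IsSolutionOn.continuousOn_rhs [T2Space X] (h : IsSolutionOn F f φ τ₀ r A τ)
    (hF : LipschitzOnBoundedSets F) {R : ℝ} (hRr : -R ≤ r) (hR : 0 ≤ R)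
    (hmem : ∀ l ∈ Icc (0 : ℝ) r, ∀ x, l - τ l x ∈ Icc (-R) l) {w : ℝ → C(X × X, ℝ)}
    (hw : ∀ l ∈ Icc (0 : ℝ) r, ∀ x y : X, w l (x, y) = A (l - τ l x) y) :
    ContinuousOn (fun l => F (A l) (τ l) (w l)) (Icc 0 r) := by
  have hA : ContinuousOn A (Icc (-R) r) := h.1.mono fun _ hs => hs.2
  have hwc : ContinuousOn w (Icc 0 r) := continuousOn_delayed hRr hA h.2.1
    (fun l hl x => ⟨(hmem l hl x).1, (hmem l hl x).2.trans hl.2⟩) hw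
  exact hF.continuous.comp_continuousOn ((hA.mono (Icc_subset_Icc_left (by linarith))).prodMk
    (h.2.1.prodMk hwc))

/-- A solution with `Lip_α` initial history is Lipschitz on compact time intervals. -/
lemma IsSolutionOn.exists_lipschitz [T2Space X] (h : IsSolutionOn F f φ τ₀ r A τ)
    (hF : LipschitzOnBoundedSets F) {α : ℝ} (hα : 0 ≤ α) (hφ : MemLipAlpha α φ) {R : ℝ}
    (hr : 0 ≤ r) (hR : 0 ≤ R) (hmem : ∀ l ∈ Icc (0 : ℝ) r, ∀ x, l - τ l x ∈ Icc (-R) l) :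
    ∃ L : ℝ, 0 ≤ L ∧ ∀ s ∈ Icc (-R) r, ∀ t ∈ Icc (-R) r, ‖A s - A t‖ ≤ L * |s - t| := by
  obtain ⟨L₁, hL₁, hlip₁⟩ := hφ.exists_lipschitz (R := R) hα
  obtain ⟨w, hw, hint⟩ := h.2.2.2.2.1
  have hG := h.continuousOn_rhs hF (by linarith) hR hmem hw
  obtain ⟨C, hC⟩ := isCompact_Icc.exists_bound_of_continuousOn hG
  have hC0 : 0 ≤ C := (norm_nonneg _).trans (hC 0 ⟨le_rfl, hr⟩)
  have hlip₂ : ∀ s ∈ Icc (0 : ℝ) r, ∀ t ∈ Icc (0 : ℝ) r, ‖A s - A t‖ ≤ C * |s - t| := by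
    intro s hs t ht
    refine (ContinuousMap.norm_le _ (by positivity)).2 fun x => ?_
    have hi : ∀ {u v : ℝ}, u ∈ Icc (0 : ℝ) r → v ∈ Icc (0 : ℝ) r →
        IntervalIntegrable (fun l => F (A l) (τ l) (w l) x) volume u v := fun hu hv =>
      ((hG.continuousMap_eval x).mono (uIcc_subset_Icc hu hv)).intervalIntegrable
    have h0 : (0 : ℝ) ∈ Icc (0 : ℝ) r := ⟨le_rfl, hr⟩
    have e := intervalIntegral.integral_interval_sub_left (hi h0 hs) (hi h0 ht)
    have e' : (A s - A t) x = ∫ l in t..s, F (A l) (τ l) (w l) x := by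
      rw [← e, ContinuousMap.sub_apply, hint s hs x, hint t ht x]
      ring
    rw [e']
    exact intervalIntegral.norm_integral_le_of_norm_le_const fun l hl =>
      ((F (A l) (τ l) (w l)).norm_coe_le_norm x).trans
        (hC l (uIcc_subset_Icc ht hs (uIoc_subset_uIcc hl)))
  have key : ∀ s ∈ Icc (-R) r, ∀ t ∈ Icc (-R) r, s ≤ t →
      ‖A s - A t‖ ≤ (L₁ + C) * |s - t| := by
    intro s hs t ht hst
    have hnn := abs_nonneg (s - t)
    rcases le_total t 0 with ht0 | ht0
    · have := hlip₁ s ⟨hs.1, hst.trans ht0⟩ t ⟨ht.1, ht0⟩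
      rw [h.2.2.2.1 s (hst.trans ht0), h.2.2.2.1 t ht0]
      nlinarith
    · rcases le_total 0 s with hs0 | hs0
      · have := hlip₂ s ⟨hs0, hs.2⟩ t ⟨ht0, ht.2⟩
        nlinarith
      · have h1 := hlip₁ s ⟨hs.1, hs0⟩ 0 ⟨by linarith, le_rfl⟩
        have h2 := hlip₂ 0 ⟨le_rfl, hr⟩ t ⟨ht0, ht.2⟩
        rw [← h.2.2.2.1 s hs0, ← h.2.2.2.1 0 le_rfl] at h1
        have h3 := norm_sub_le_norm_sub_add_norm_sub (A s) (A 0) (A t)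
        rw [abs_of_nonpos (by linarith)] at h1 h2 ⊢
        nlinarith
  refine ⟨L₁ + C, by positivity, fun s hs t ht => ?_⟩
  rcases le_total s t with hst | hst
  · exact key s hs t ht hst
  · rw [norm_sub_rev, abs_sub_comm]
    exact key t ht s hs hst

end Solution

/-- Continuous dependence over a general compact Hausdorff space, without monotonicity of `f`. -/
lemma continuous_dependence [T2Space X] {f : C(X, ℝ) → C(X, ℝ)} {Kf : ℝ≥0}
    (hf_lip : LipschitzWith Kf f) {N : ℝ} (hN : 0 < N)
    (hf_bdd : ∀ (ψ : C(X, ℝ)) (x : X), 0 < f ψ x ∧ f ψ x ≤ N)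
    {F : C(X, ℝ) → C(X, ℝ) → C(X × X, ℝ) → C(X, ℝ)} (hF : LipschitzOnBoundedSets F)
    {α : ℝ} (hα : 0 ≤ α) {r : ℝ} (hr : 0 < r)
    {ψ : ℝ → C(X, ℝ)} (hψ : MemLipAlpha α ψ) {σ₀ : C(X, ℝ)} (hσ₀ : ∀ x, 0 ≤ σ₀ x)
    {B σ : ℝ → C(X, ℝ)} (hB : IsSolutionOn F f ψ σ₀ r B σ) {ε : ℝ} (hε : 0 < ε) :
    ∃ δ : ℝ, 0 < δ ∧
      ∀ φ : ℝ → C(X, ℝ), ∀ τ₀ : C(X, ℝ), ∀ A τ : ℝ → C(X, ℝ),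
        MemLipAlpha α φ → (∀ x, 0 ≤ τ₀ x) →
        lipAlphaNorm α (fun t : ℝ => φ t - ψ t) + ‖τ₀ - σ₀‖ ≤ δ →
        IsSolutionOn F f φ τ₀ r A τ →
        ∀ t ∈ Icc (0 : ℝ) r, ‖A t - B t‖ ≤ ε := by
  have hfc : Continuous f := hf_lip.continuous
  have hpos : ∀ ψ x, 0 < f ψ x := fun ψ x => (hf_bdd ψ x).1
  obtain ⟨R, hR⟩ : ∃ R, R = ‖σ₀‖ + 1 := ⟨_, rfl⟩
  have hR0 : 0 < R := by rw [hR]; positivity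
  have hBmem : ∀ l ∈ Icc (0 : ℝ) r, ∀ x, l - σ l x ∈ Icc (-R) l := fun l hl x =>
    hB.sub_delay_mem hfc hpos hσ₀ (by linarith) hl x
  have hBc : ContinuousOn B (Icc (-R) r) := hB.1.mono fun _ hs => hs.2
  obtain ⟨LB, hLB0, hLB⟩ := hB.exists_lipschitz hF hα hψ hr.le hR0.le hBmem
  obtain ⟨MB, hMB⟩ := isCompact_Icc.exists_bound_of_continuousOn hBc
  obtain ⟨m, hm0, hm⟩ : ∃ m : ℝ, 0 < m ∧ ∀ s ∈ Icc (-R) r, ∀ x, m ≤ f (B s) x := by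
    have hc : ContinuousOn (fun p : ℝ × X => f (B p.1) p.2) (Icc (-R) r ×ˢ univ) := by
      have h1 : ContinuousOn (fun p : ℝ × X => f (B p.1)) (Icc (-R) r ×ˢ univ) :=
        (hfc.comp_continuousOn hBc).comp continuousOn_fst fun p hp => hp.1
      exact h1.eval continuousOn_snd
    obtain ⟨m, hm0, hm⟩ := (isCompact_Icc.prod isCompact_univ).exists_forall_le' hc
      (a := 0) fun p _ => hpos _ _
    exact ⟨m, hm0, fun s hs x => hm (s, x) ⟨hs, mem_univ _⟩⟩
  have hMB0 : 0 ≤ MB := (norm_nonneg _).trans (hMB 0 ⟨by linarith, hr.le⟩)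
  obtain ⟨LF, hLF0, hLF⟩ := hF (MB + 1 + R + r) (by linarith)
  obtain ⟨C₁, hC₁⟩ : ∃ C₁, C₁ = (N + 2 * Kf * (R + r)) / m := ⟨_, rfl⟩
  have hC₁0 : 0 ≤ C₁ := by rw [hC₁]; positivity
  obtain ⟨C, hC⟩ : ∃ C, C = LF * (2 + C₁ + LB * C₁) := ⟨_, rfl⟩
  have hC0 : 0 < C := by rw [hC]; positivity
  obtain ⟨K, hK⟩ : ∃ K, K = Real.exp (α * R) + 2 := ⟨_, rfl⟩
  have hK2 : 2 < K := by rw [hK]; linarith [Real.exp_pos (α * R)]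
  have hP : 0 < K * Real.exp (2 * C * r) := by positivity
  obtain ⟨δ, hδ⟩ : ∃ δ, δ = min 1 (min 1 ε / (K * Real.exp (2 * C * r))) := ⟨_, rfl⟩
  have hδ0 : 0 < δ := by rw [hδ]; positivity
  have hδ1 : δ ≤ 1 := by rw [hδ]; exact min_le_left _ _
  have hδ2 : K * δ * Real.exp (2 * C * r) ≤ min 1 ε := by
    have : δ ≤ min 1 ε / (K * Real.exp (2 * C * r)) := by rw [hδ]; exact min_le_right _ _
    rw [le_div_iff₀ hP] at this
    linarith
  refine ⟨δ, hδ0, fun φ τ₀ A τ hφ hτ₀ hclose hA => ?_⟩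
  obtain ⟨hτδ, hφδ⟩ := norm_sub_le_of_lipAlphaNorm_add_le hφ hψ (norm_nonneg _) hclose
  have hτ₀R : ‖τ₀‖ ≤ R := by
    have := norm_le_norm_add_norm_sub σ₀ τ₀
    rw [norm_sub_rev] at this
    linarith
  have hAmem : ∀ l ∈ Icc (0 : ℝ) r, ∀ x, l - τ l x ∈ Icc (-R) l := fun l hl x =>
    hA.sub_delay_mem hfc hpos hτ₀ hτ₀R hl x
  have hAc : ContinuousOn A (Icc (-R) r) := hA.1.mono fun _ hs => hs.2
  obtain ⟨w, hw, hAint⟩ := hA.2.2.2.2.1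
  obtain ⟨v, hv, hBint⟩ := hB.2.2.2.2.1
  have hGA := hA.continuousOn_rhs hF (by linarith) hR0.le hAmem hw
  have hGB := hB.continuousOn_rhs hF (by linarith) hR0.le hBmem hv
  obtain ⟨E, hE⟩ : ∃ E : ℝ → ℝ, E = fun t => K * δ * Real.exp (2 * C * t) := ⟨_, rfl⟩
  have hEmono : Monotone E := by
    intro s t hst
    rw [hE]
    dsimp only
    gcongr
  have hE0 : K * δ = E 0 := by simp [hE]
  have hEδ : ∀ t, 0 ≤ t → δ ≤ E t := fun t ht => by
    have := hEmono ht
    nlinarith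
  have hEr : E r ≤ min 1 ε := by rw [hE]; exact hδ2
  have hE1 : ∀ t ≤ r, E t ≤ 1 := fun t ht => (hEmono ht).trans (hEr.trans (min_le_left _ _))
  have hhist : ∀ s ∈ Icc (-R) 0, ‖A s - B s‖ ≤ E 0 := by
    intro s hs
    rw [hA.2.2.2.1 s hs.2, hB.2.2.2.1 s hs.2, ← hE0]
    refine (hφδ s hs.2).trans (mul_le_mul_of_nonneg_right ?_ hδ0.le)
    have : Real.exp (α * |s|) ≤ Real.exp (α * R) := by
      refine Real.exp_le_exp.2 (mul_le_mul_of_nonneg_left ?_ hα)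
      rw [abs_of_nonpos hs.2]
      linarith [hs.1]
    linarith
  have hu0 : ‖A 0 - B 0‖ ≤ δ := by
    rw [hA.2.2.2.1 0 le_rfl, hB.2.2.2.1 0 le_rfl]
    simpa using hφδ 0 le_rfl
  -- As long as the two solutions are `E`-close, so are the delays and the right-hand sides.
  have hrhs : ∀ l ∈ Icc (0 : ℝ) r, (∀ s ∈ Icc (-R) l, ‖A s - B s‖ ≤ E l) →
      ‖F (A l) (τ l) (w l) - F (B l) (σ l) (v l)‖ ≤ C * E l := by
    intro l hl hcl
    have hEl0 : 0 ≤ E l := hδ0.le.trans (hEδ l hl.1)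
    have hsub : ∀ s ∈ Icc (-R) l, s ∈ Icc (-R) r := fun s hs => ⟨hs.1, hs.2.trans hl.2⟩
    have hll : l ∈ Icc (-R) l := ⟨by linarith [hl.1], le_rfl⟩
    have hBb : ∀ s ∈ Icc (-R) l, ‖B s‖ ≤ MB + 1 + R + r := fun s hs => by
      linarith [hMB s (hsub s hs)]
    have hAb : ∀ s ∈ Icc (-R) l, ‖A s‖ ≤ MB + 1 + R + r := fun s hs => by
      linarith [hMB s (hsub s hs), norm_le_norm_add_norm_sub (B s) (A s), hcl s hs, hE1 l hl.2,
        norm_sub_rev (A s) (B s)]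
    have hdelay : ∀ x, |τ l x - σ l x| ≤ C₁ * E l := by
      intro x
      have hst := threshold_stability (g := fun s => f (A s) x) (k := fun s => f (B s) x)
        (N := N) (η := Kf * E l) (a₀ := -τ₀ x) (b₀ := -σ₀ x)
        ((hfc.comp_continuousOn hAc).continuousMap_eval x)
        ((hfc.comp_continuousOn hBc).continuousMap_eval x)
        (fun s hs => hm s hs x)
        (fun s _ => by rw [abs_of_pos (hpos _ x)]; exact (hf_bdd _ x).2) hl
        ⟨by linarith [(le_abs_self _).trans (τ₀.norm_coe_le_norm x)], by linarith [hτ₀ x]⟩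
        ⟨by linarith [(le_abs_self _).trans (σ₀.norm_coe_le_norm x)], by linarith [hσ₀ x]⟩
        (hAmem l hl x) (hBmem l hl x)
        ((hA.2.2.2.2.2 l hl x).trans (intervalIntegral.integral_congr fun s hs => by
          rw [uIcc_of_le (by linarith [hτ₀ x])] at hs
          simp only [hA.2.2.2.1 s hs.2]))
        ((hB.2.2.2.2.2 l hl x).trans (intervalIntegral.integral_congr fun s hs => by
          rw [uIcc_of_le (by linarith [hσ₀ x])] at hs
          simp only [hB.2.2.2.1 s hs.2]))
        (by positivity)
        (fun s hs => (abs_apply_sub_apply_le _ _ x).trans ((hf_lip.norm_sub_le _ _).trans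
          (mul_le_mul_of_nonneg_left (hcl s hs) Kf.2)))
      have h1 : |-τ₀ x - -σ₀ x| ≤ E l := by
        rw [show -τ₀ x - -σ₀ x = -(τ₀ x - σ₀ x) by ring, abs_neg]
        exact (abs_apply_sub_apply_le _ _ x).trans (hτδ.trans (hEδ l hl.1))
      rw [show l - τ l x - (l - σ l x) = -(τ l x - σ l x) by ring, abs_neg] at hst
      rw [hC₁, div_mul_eq_mul_div, le_div_iff₀ hm0]
      nlinarith [mul_le_mul_of_nonneg_left h1 hN.le]
    have hτd : ‖τ l - σ l‖ ≤ C₁ * E l :=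
      (ContinuousMap.norm_le _ (by positivity)).2 hdelay
    have hwd : ‖w l - v l‖ ≤ E l + LB * (C₁ * E l) := by
      refine (ContinuousMap.norm_le _ (by positivity)).2 fun ⟨x, y⟩ => ?_
      rw [ContinuousMap.sub_apply, hw l hl, hv l hl]
      have h1 := (abs_apply_sub_apply_le (A (l - τ l x)) (B (l - τ l x)) y).trans
        (hcl _ (hAmem l hl x))
      have h2 := (abs_apply_sub_apply_le (B (l - τ l x)) (B (l - σ l x)) y).trans
        (hLB _ (hsub _ (hAmem l hl x)) _ (hsub _ (hBmem l hl x)))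
      rw [show l - τ l x - (l - σ l x) = -(τ l x - σ l x) by ring, abs_neg] at h2
      have h3 := mul_le_mul_of_nonneg_left (hdelay x) hLB0
      rw [Real.norm_eq_abs]
      linarith [abs_sub_le (A (l - τ l x) y) (B (l - τ l x) y) (B (l - σ l x) y)]
    have hbd : ∀ {ρ : ℝ → C(X, ℝ)}, (∀ x, 0 ≤ ρ l x) → (∀ x, l - ρ l x ∈ Icc (-R) l) →
        ‖ρ l‖ ≤ MB + 1 + R + r := fun h0 hmem =>
      (ContinuousMap.norm_le _ (by positivity)).2 fun x => by
        rw [Real.norm_of_nonneg (h0 x)]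
        linarith [(hmem x).1, hl.2]
    have hwb : ‖w l‖ ≤ MB + 1 + R + r :=
      (ContinuousMap.norm_le _ (by positivity)).2 fun ⟨x, y⟩ => by
        rw [hw l hl]
        exact (ContinuousMap.norm_coe_le_norm _ _).trans (hAb _ (hAmem l hl x))
    have hvb : ‖v l‖ ≤ MB + 1 + R + r :=
      (ContinuousMap.norm_le _ (by positivity)).2 fun ⟨x, y⟩ => by
        rw [hv l hl]
        exact (ContinuousMap.norm_coe_le_norm _ _).trans (hBb _ (hBmem l hl x))
    refine (hLF _ _ _ _ _ _ (hAb l hll) (hbd (hA.2.2.1 l hl) (hAmem l hl)) hwb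
      (hBb l hll) (hbd (hB.2.2.1 l hl) (hBmem l hl)) hvb).trans ?_
    rw [hC, mul_assoc]
    refine mul_le_mul_of_nonneg_left ?_ hLF0.le
    linarith [hcl l hll]
  have hmain : ∀ t ∈ Icc (0 : ℝ) r, ‖A t - B t‖ - E t < 0 := by
    have hEc : Continuous E := by rw [hE]; fun_prop
    refine neg_of_forall_nonpos_imp_neg ?_ ?_ fun t ht hle => ?_
    · have hs : Icc (0 : ℝ) r ⊆ Icc (-R) r := Icc_subset_Icc_left (by linarith)
      exact ((hAc.mono hs).sub (hBc.mono hs)).norm.sub hEc.continuousOn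
    · nlinarith
    · have hcl : ∀ l ∈ Icc (0 : ℝ) t, ∀ s ∈ Icc (-R) l, ‖A s - B s‖ ≤ E l := by
        intro l hl s hs
        rcases le_total s 0 with h | h
        · exact (hhist s ⟨hs.1, h⟩).trans (hEmono hl.1)
        · exact (sub_nonpos.1 (hle s ⟨h, hs.2.trans hl.2⟩)).trans (hEmono hs.2)
      have hEint : ∫ l in (0 : ℝ)..t, C * E l = (E t - K * δ) / 2 := by
        rw [intervalIntegral.integral_eq_sub_of_hasDerivAt (f := fun l => E l / 2)
          (f' := fun l => C * E l) (fun l _ => ?_)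
          ((continuous_const.mul hEc).intervalIntegrable 0 t), hE0]
        · ring
        · have h1 : HasDerivAt (fun l => 2 * C * l) (2 * C) l := by
            simpa using (hasDerivAt_id l).const_mul (2 * C)
          have h2 := (h1.exp.const_mul (K * δ)).div_const 2
          simp only [hE]
          refine h2.congr_deriv ?_
          ring
      have hbound : ‖A t - B t‖ ≤ δ + (E t - K * δ) / 2 := by
        have hEt := hEmono ht.1
        refine (ContinuousMap.norm_le _ (by linarith)).2 fun x => ?_
        have hsub : uIcc 0 t ⊆ Icc 0 r := by
          rw [uIcc_of_le ht.1]; exact Icc_subset_Icc_right ht.2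
        have hd : (A t - B t) x = (A 0 x - B 0 x) +
            ∫ l in (0 : ℝ)..t, (F (A l) (τ l) (w l) x - F (B l) (σ l) (v l) x) := by
          rw [intervalIntegral.integral_sub
            ((hGA.continuousMap_eval x).mono hsub).intervalIntegrable
            ((hGB.continuousMap_eval x).mono hsub).intervalIntegrable,
            ContinuousMap.sub_apply, hAint t ht x, hBint t ht x, hA.2.2.2.1 0 le_rfl,
            hB.2.2.2.1 0 le_rfl]
          ring
        rw [hd, ← hEint]
        refine (norm_add_le _ _).trans (add_le_add
          ((abs_apply_sub_apply_le _ _ x).trans hu0) ?_)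
        refine intervalIntegral.norm_integral_le_of_norm_le ht.1 (ae_of_all _ fun l hl => ?_)
          ((continuous_const.mul hEc).intervalIntegrable 0 t)
        exact (abs_apply_sub_apply_le _ _ x).trans
          (hrhs l ⟨hl.1.le, hl.2.trans ht.2⟩ (hcl l ⟨hl.1.le, hl.2⟩))
      have := hEδ t ht.1
      nlinarith
  exact fun t ht => (sub_neg.1 (hmain t ht)).le.trans
    ((hEmono ht.2).trans (hEr.trans (min_le_right _ _)))

end

/-- continuous dependence of solutions on the initial distribution:
given a solution (Ā,τ̄) on [0,t*], for every ε > 0 there is δ > 0 such that every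
solution (A,τ) on [0,t*] whose initial distribution (φ,τ₀) satisfies
‖φ − φ̄‖_{Lip_α} + ‖τ₀ − τ̄₀‖_∞ ≤ δ stays ε-close: sup_{t∈[0,t*]}‖A(t,·) − Ā(t,·)‖_∞ ≤ ε. -/
theorem stmt_19
    {n : ℕ} (hn : 1 ≤ n)
    (Ω : Set (EuclideanSpace ℝ (Fin n))) (hΩ : IsCompact Ω) [CompactSpace Ω]
    (f : C(Ω, ℝ) → C(Ω, ℝ)) (Kf : ℝ≥0) (hf_lip : LipschitzWith Kf f)
    (hf_mono : ∀ u v : C(Ω, ℝ), u ≤ v → f v ≤ f u)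
    (Mbar : ℝ) (hMbar : 0 < Mbar)
    (hf_bdd : ∀ (ψ : C(Ω, ℝ)) (x : Ω), 0 < f ψ x ∧ f ψ x ≤ Mbar)
    (F : C(Ω, ℝ) → C(Ω, ℝ) → C(Ω × Ω, ℝ) → C(Ω, ℝ))
    (hF : LipschitzOnBoundedSets F)
    (α : ℝ) (hα : 0 ≤ α)
    (tstar : ℝ) (htstar : 0 < tstar)
    (φbar : ℝ → C(Ω, ℝ)) (hφbar : MemLipAlpha α φbar)
    (τ₀bar : C(Ω, ℝ)) (hτ₀bar : ∀ x, 0 ≤ τ₀bar x)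
    (Abar τbar : ℝ → C(Ω, ℝ))
    (hsolbar : IsSolutionOn F f φbar τ₀bar tstar Abar τbar) :
    ∀ ε : ℝ, 0 < ε → ∃ δ : ℝ, 0 < δ ∧
      ∀ φ : ℝ → C(Ω, ℝ), ∀ τ₀ : C(Ω, ℝ), ∀ A τ : ℝ → C(Ω, ℝ),
        MemLipAlpha α φ → (∀ x, 0 ≤ τ₀ x) →
        lipAlphaNorm α (fun t : ℝ => φ t - φbar t) + ‖τ₀ - τ₀bar‖ ≤ δ →
        IsSolutionOn F f φ τ₀ tstar A τ →
        ∀ t ∈ Set.Icc (0 : ℝ) tstar, ‖A t - Abar t‖ ≤ ε := by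
  exact fun ε hε => continuous_dependence hf_lip hMbar hf_bdd hF hα htstar hφbar hτ₀bar hsolbar hε
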